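/- Distance bound for generalized concatenated quantum codes (Theorem 1, part 3, Eq. (16)): In the GCQC setup, suppose there is an index μ ∈ {1,…,m} such that the outer code A_i is nondegenerate for every i < μ (A_μ being the first possibly degenerate outer code). Then every element of S_𝒞^⊥ ∖ S_𝒞 has symplectic weight at least min{d₁D₁, d₂D₂, …, d_{μ−1}D_{μ−1}, d_μ · min_{μ ≤ i ≤ m} D_i}; i.e., the minimum distance 𝒟 of the GCQC satisfies 𝒟 ≥ min{d₁D₁, …, d_{μ−1}D_{μ−1}, d_μ · min_{μ ≤ i ≤ m} D_i}. -/

import Mathlib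

open Finset

/-- Pauli operators (up to phase) on `n` qubits, as symplectic vectors. -/
abbrev Pauli (n : ℕ) := Fin n → (ZMod 2) × (ZMod 2)

/-- The outer space `W = (𝔽₂^r × 𝔽₂^r)^N`. -/
abbrev Outer (r N : ℕ) := Fin N → (Fin r → ZMod 2) × (Fin r → ZMod 2)

/-- `N` blocks of `n` qubits each. -/
abbrev PauliB (n N : ℕ) := Fin N → Pauli n

/-- Elementary symplectic form on one qubit. -/
def B0 : LinearMap.BilinForm (ZMod 2) ((ZMod 2) × (ZMod 2)) :=
  LinearMap.mk₂ (ZMod 2) (fun u v => u.1 * v.2 + v.1 * u.2)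
    (fun a b v => by simp; ring)
    (fun c a v => by simp; ring)
    (fun a b v => by simp; ring)
    (fun c a v => by simp; ring)

/-- Sum of a bilinear form over `N` coordinates. -/
def sumForm {M : Type*} [AddCommGroup M] [Module (ZMod 2) M] (N : ℕ)
    (B : LinearMap.BilinForm (ZMod 2) M) :
    LinearMap.BilinForm (ZMod 2) (Fin N → M) :=
  LinearMap.mk₂ (ZMod 2) (fun u v => ∑ j, B (u j) (v j))
    (fun a b v => by simp [Finset.sum_add_distrib])
    (fun c a v => by simp [Finset.mul_sum])
    (fun a b v => by simp [Finset.sum_add_distrib])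
    (fun c a v => by simp [Finset.mul_sum])

/-- Symplectic form on `r`-qubit blocks written as pairs of binary `r`-vectors. -/
def pairForm (r : ℕ) : LinearMap.BilinForm (ZMod 2) ((Fin r → ZMod 2) × (Fin r → ZMod 2)) :=
  LinearMap.mk₂ (ZMod 2) (fun u v => ∑ ℓ, (u.1 ℓ * v.2 ℓ + v.1 ℓ * u.2 ℓ))
    (fun a b v => by rw [← Finset.sum_add_distrib]; refine Finset.sum_congr rfl fun ℓ _ => by simp; ring)
    (fun c a v => by rw [smul_eq_mul, Finset.mul_sum]; refine Finset.sum_congr rfl fun ℓ _ => by simp; ring)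
    (fun a b v => by rw [← Finset.sum_add_distrib]; refine Finset.sum_congr rfl fun ℓ _ => by simp; ring)
    (fun c a v => by rw [smul_eq_mul, Finset.mul_sum]; refine Finset.sum_congr rfl fun ℓ _ => by simp; ring)

/-- Symplectic form on `Pauli n`. -/
def symplF (n : ℕ) : LinearMap.BilinForm (ZMod 2) (Pauli n) := sumForm n B0

/-- Symplectic form on `N` blocks of `n` qubits. -/
def symplFB (n N : ℕ) : LinearMap.BilinForm (ZMod 2) (PauliB n N) := sumForm N (symplF n)

/-- Symplectic form on the outer space `W_i`. -/
def symplFO (r N : ℕ) : LinearMap.BilinForm (ZMod 2) (Outer r N) := sumForm N (pairForm r)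

/-- Orthogonal complement of a subspace w.r.t. a bilinear form. -/
def perp {M : Type*} [AddCommGroup M] [Module (ZMod 2) M]
    (B : LinearMap.BilinForm (ZMod 2) M) (S : Submodule (ZMod 2) M) :
    Submodule (ZMod 2) M where
  carrier := {v | ∀ s ∈ S, B s v = 0}
  add_mem' := fun hu hv s hs => by
    rw [map_add, hu s hs, hv s hs, add_zero]
  zero_mem' := fun s hs => by simp
  smul_mem' := fun c v hv s hs => by
    rw [map_smul, hv s hs, smul_zero]

/-- Generic weight: number of nonzero coordinates. -/
def wgt {N : ℕ} {M : Type*} [Zero M] [DecidableEq M] (v : Fin N → M) : ℕ :=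
  (Finset.univ.filter fun j => v j ≠ 0).card

/-- Symplectic weight on `N` blocks of `n` qubits: number of nonzero qubit positions. -/
def swtB {n N : ℕ} (v : PauliB n N) : ℕ := ∑ j, wgt (v j)

/-- Stabilizer of the subcode `B_i`: `S` together with the logical `z`'s of index `< kk`. -/
def Sstab (n : ℕ) (S : Submodule (ZMod 2) (Pauli n)) (z : ℕ → Pauli n) (kk : ℕ) :
    Submodule (ZMod 2) (Pauli n) :=
  S ⊔ Submodule.span (ZMod 2) (z '' Set.Iio kk)

/-- Span of the logical operators `x_t, z_t` with `a ≤ t < b` (0-based indexing). -/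
def Lspan (n : ℕ) (x z : ℕ → Pauli n) (a b : ℕ) : Submodule (ZMod 2) (Pauli n) :=
  Submodule.span (ZMod 2) ((x '' Set.Ico a b) ∪ (z '' Set.Ico a b))

/-- The block-wise inner stabilizer `S_I`. -/
def SI (n N : ℕ) (S : Submodule (ZMod 2) (Pauli n)) : Submodule (ZMod 2) (PauliB n N) :=
  Submodule.pi (Set.univ : Set (Fin N)) (fun _ => S)

/-- The replacement map `φ` with offset `off`, sending the `ℓ`-th binary coordinates of each
block to the logical operators `x (off+ℓ)`, `z (off+ℓ)` of the inner code. -/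
def phi (n N : ℕ) (x z : ℕ → Pauli n) (off r : ℕ) :
    Outer r N →ₗ[ZMod 2] PauliB n N where
  toFun w := fun j =>
    (∑ ℓ : Fin r, (w j).1 ℓ • x (off + ℓ)) + (∑ ℓ : Fin r, (w j).2 ℓ • z (off + ℓ))
  map_add' := fun a b => by
    funext j
    simp [add_smul, Finset.sum_add_distrib]
    abel
  map_smul' := fun c a => by
    funext j
    simp [mul_smul, Finset.smul_sum, smul_add]

theorem symplF_comm {n : ℕ} (u v : Pauli n) : symplF n u v = symplF n v u := by
  simp only [symplF, sumForm, B0, LinearMap.mk₂_apply]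
  exact Finset.sum_congr rfl fun _ _ => add_comm _ _

theorem apply_eq_zero_of_mem_Sstab {n kk : ℕ} {S : Submodule (ZMod 2) (Pauli n)}
    {z : ℕ → Pauli n} {y u : Pauli n} (hyS : y ∈ perp (symplF n) S)
    (hyz : ∀ s < kk, symplF n y (z s) = 0) (hu : u ∈ Sstab n S z kk) : symplF n y u = 0 := by
  have hle : Sstab n S z kk ≤ LinearMap.ker (symplF n y) := by
    refine sup_le (fun s hs => ?_) (Submodule.span_le.2 ?_)
    · rw [LinearMap.mem_ker, symplF_comm]
      exact hyS s hs
    · rintro _ ⟨s, hs, rfl⟩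
      exact hyz s hs
  exact hle hu

theorem mem_perp_Sstab {n kk : ℕ} {S : Submodule (ZMod 2) (Pauli n)}
    {z : ℕ → Pauli n} {u : Pauli n} (huS : u ∈ perp (symplF n) S)
    (huz : ∀ t < kk, symplF n (z t) u = 0) : u ∈ perp (symplF n) (Sstab n S z kk) := by
  intro s hs
  rw [symplF_comm]
  exact apply_eq_zero_of_mem_Sstab huS (fun t ht => by rw [symplF_comm]; exact huz t ht) hs

/-- The coordinates of `v` along the logical operators with indices in `[off, off + r)`. -/
def outerCoord {n N : ℕ} (x z : ℕ → Pauli n) (off r : ℕ) (v : PauliB n N) : Outer r N :=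
  fun j => (fun ℓ => symplF n (z (off + ℓ)) (v j), fun ℓ => symplF n (x (off + ℓ)) (v j))

theorem symplFB_phi {n N : ℕ} (x z : ℕ → Pauli n) (off r : ℕ) (w : Outer r N)
    (v : PauliB n N) :
    symplFB n N (phi n N x z off r w) v = symplFO r N w (outerCoord x z off r v) := by
  simp only [symplFB, symplFO, sumForm, LinearMap.mk₂_apply, phi, LinearMap.coe_mk,
    AddHom.coe_mk, pairForm, outerCoord, map_add, map_sum, map_smul, LinearMap.add_apply,
    LinearMap.sum_apply, LinearMap.smul_apply, smul_eq_mul, Finset.sum_add_distrib, mul_comm]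

/-- The component of a Pauli operator along the first `K` pairs of logical operators. -/
def logicalPart {n : ℕ} (x z : ℕ → Pauli n) (K : ℕ) : Pauli n →ₗ[ZMod 2] Pauli n :=
  ∑ t ∈ Finset.range K,
    ((symplF n (z t)).smulRight (x t) + (symplF n (x t)).smulRight (z t))

theorem logicalPart_apply {n : ℕ} (x z : ℕ → Pauli n) (K : ℕ) (u : Pauli n) :
    logicalPart x z K u =
      ∑ t ∈ Finset.range K, (symplF n (z t) u • x t + symplF n (x t) u • z t) := by
  simp [logicalPart, LinearMap.sum_apply]

theorem logicalPart_add {n N : ℕ} (x z : ℕ → Pauli n) (off r : ℕ) (v : PauliB n N)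
    (j : Fin N) :
    logicalPart x z (off + r) (v j) =
      logicalPart x z off (v j) + phi n N x z off r (outerCoord x z off r v) j := by
  simp only [logicalPart_apply, Finset.sum_range_add, phi, LinearMap.coe_mk, AddHom.coe_mk,
    outerCoord, ← Finset.sum_add_distrib]
  congr 1
  rw [Finset.sum_range]

theorem sub_logicalPart_mem {n K : ℕ} {S : Submodule (ZMod 2) (Pauli n)} {x z : ℕ → Pauli n}
    (hxS : ∀ t < K, x t ∈ perp (symplF n) S)
    (hzS : ∀ t < K, z t ∈ perp (symplF n) S)
    (hxx : ∀ s < K, ∀ t < K, symplF n (x s) (x t) = 0)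
    (hzz : ∀ s < K, ∀ t < K, symplF n (z s) (z t) = 0)
    (hxz : ∀ s < K, ∀ t < K, symplF n (x s) (z t) = if s = t then 1 else 0)
    {u : Pauli n} (hu : u ∈ S ⊔ Lspan n x z 0 K) : u - logicalPart x z K u ∈ S := by
  obtain ⟨s, hs, l, hl, rfl⟩ := Submodule.mem_sup.1 hu
  have hs0 : logicalPart x z K s = 0 := by
    rw [logicalPart_apply]
    refine Finset.sum_eq_zero fun t ht => ?_
    rw [Finset.mem_range] at ht
    rw [symplF_comm, hzS t ht s hs, symplF_comm, hxS t ht s hs, zero_smul, zero_smul, add_zero]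
  have hl0 : logicalPart x z K l = l := by
    have h : Set.EqOn (logicalPart x z K) (LinearMap.id : Pauli n →ₗ[ZMod 2] Pauli n) (Lspan n x z 0 K) := by
      refine LinearMap.eqOn_span ?_
      rintro _ (⟨t, ht, rfl⟩ | ⟨t, ht, rfl⟩)
      · have ht := (Set.mem_Ico.1 ht).2
        rw [logicalPart_apply, Finset.sum_eq_single_of_mem t (Finset.mem_range.2 ht)]
        · rw [symplF_comm, hxz t ht t ht, hxx t ht t ht]; simp
        · intro b hb hbt
          rw [Finset.mem_range] at hb
          rw [symplF_comm, hxz t ht b hb, hxx b hb t ht, if_neg hbt.symm]; simp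
      · have ht := (Set.mem_Ico.1 ht).2
        rw [logicalPart_apply, Finset.sum_eq_single_of_mem t (Finset.mem_range.2 ht)]
        · rw [hxz t ht t ht, hzz t ht t ht]; simp
        · intro b hb hbt
          rw [Finset.mem_range] at hb
          rw [hxz b hb t ht, hzz b hb t ht, if_neg hbt]; simp
    exact h hl
  rw [map_add, hs0, hl0]
  simpa using hs

theorem sum_phi_eq_logicalPart {n N m : ℕ} {k : ℕ → ℕ}
    (hk : ∀ i, 1 ≤ i → i ≤ m → k (i + 1) < k i) (hk1 : ∀ i, 1 ≤ i → i ≤ m → k i ≤ k 1)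
    (x z : ℕ → Pauli n) (v : PauliB n N) (j : Fin N) {p : ℕ} (hp : p ≤ m) :
    ∑ i ∈ Finset.Icc 1 p, phi n N x z (k 1 - k i) (k i - k (i + 1))
      (outerCoord x z (k 1 - k i) (k i - k (i + 1)) v) j =
      logicalPart x z (k 1 - k (p + 1)) (v j) := by
  induction p with
  | zero => simp [logicalPart_apply]
  | succ p ih =>
    have h1 := hk (p + 1) (by omega) hp
    have h2 := hk1 (p + 1) (by omega) hp
    rw [Finset.sum_Icc_succ_top (by omega), ih (by omega), ← logicalPart_add]
    congr 2
    omega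

theorem symplF_eq_zero_of_outerCoord_eq_zero {n N m : ℕ} {k : ℕ → ℕ} {x z : ℕ → Pauli n}
    {v : PauliB n N} {p : ℕ} (hp : p ≤ m)
    (h0 : ∀ i, 1 ≤ i → i ≤ p → outerCoord x z (k 1 - k i) (k i - k (i + 1)) v = 0)
    (j : Fin N) {t : ℕ} (ht : t < k 1 - k (p + 1)) : symplF n (z t) (v j) = 0 := by
  induction p with
  | zero => simp at ht
  | succ p ih =>
    by_cases hlt : t < k 1 - k (p + 1)
    · exact ih (by omega) (fun i h1 h2 => h0 i h1 (by omega)) hlt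
    · have h := congrFun (congrArg Prod.fst (congrFun (h0 (p + 1) (by omega) le_rfl) j))
        ⟨t - (k 1 - k (p + 1)), by omega⟩
      simpa [outerCoord, Nat.add_sub_cancel' (not_lt.1 hlt)] using h

theorem mul_wgt_le_swtB {n N r a : ℕ} (v : PauliB n N) (w : Outer r N)
    (h : ∀ j, w j ≠ 0 → a ≤ wgt (v j)) : a * wgt w ≤ swtB v := by
  calc a * wgt w = ∑ j ∈ Finset.univ.filter fun j => w j ≠ 0, a := by
        rw [Finset.sum_const, smul_eq_mul, mul_comm, wgt]
    _ ≤ ∑ j ∈ Finset.univ.filter fun j => w j ≠ 0, wgt (v j) :=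
        Finset.sum_le_sum fun j hj => h j (Finset.mem_filter.1 hj).2
    _ ≤ swtB v := Finset.sum_le_sum_of_subset (Finset.filter_subset _ _)

/-- Theorem 1, part 3 (Eq. (16)): distance bound for a GCQC where the outer codes
`A_1, …, A_{μ-1}` are nondegenerate. The conclusion states that
`swtB v ≥ min{d_1 D_1, …, d_{μ-1} D_{μ-1}, d_μ · min_{μ ≤ i ≤ m} D_i}`, phrased as:
every `c` that is a lower bound for all the quantities in the minimum is a lower
bound for `swtB v`. -/
theorem gcqc_distance_bound
    (n N m : ℕ) (hm : 1 ≤ m)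
    (k : ℕ → ℕ) (hk : ∀ i, 1 ≤ i → i ≤ m → k (i + 1) < k i) (hklast : k (m + 1) = 0)
    (hkn : k 1 ≤ n)
    (S : Submodule (ZMod 2) (Pauli n))
    (hSorth : S ≤ perp (symplF n) S)
    (hSdim : Module.finrank (ZMod 2) S = n - k 1)
    (x z : ℕ → Pauli n)
    (hxS : ∀ t < k 1, x t ∈ perp (symplF n) S)
    (hzS : ∀ t < k 1, z t ∈ perp (symplF n) S)
    (hxx : ∀ s < k 1, ∀ t < k 1, symplF n (x s) (x t) = 0)
    (hzz : ∀ s < k 1, ∀ t < k 1, symplF n (z s) (z t) = 0)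
    (hxz : ∀ s < k 1, ∀ t < k 1, symplF n (x s) (z t) = if s = t then 1 else 0)
    (hdual : perp (symplF n) S = S ⊔ Lspan n x z 0 (k 1))
    (hdisj : Disjoint S (Lspan n x z 0 (k 1)))
    (d : ℕ → ℕ)
    (hd : ∀ i, 1 ≤ i → i ≤ m + 1 → ∀ v ∈ perp (symplF n) (Sstab n S z (k 1 - k i)),
      v ∉ Sstab n S z (k 1 - k i) → d i ≤ wgt v)
    (K D : ℕ → ℕ) (hKN : ∀ i, 1 ≤ i → i ≤ m → K i ≤ N)
    (SA : ∀ i : ℕ, Submodule (ZMod 2) (Outer (k i - k (i + 1)) N))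
    (hSAorth : ∀ i, 1 ≤ i → i ≤ m → SA i ≤ perp (symplFO (k i - k (i + 1)) N) (SA i))
    (hSAdim : ∀ i, 1 ≤ i → i ≤ m →
      Module.finrank (ZMod 2) (SA i) = (k i - k (i + 1)) * (N - K i))
    (hSAdist : ∀ i, 1 ≤ i → i ≤ m → ∀ w ∈ perp (symplFO (k i - k (i + 1)) N) (SA i),
      w ∉ SA i → D i ≤ wgt w)
    (SC : Submodule (ZMod 2) (PauliB n N))
    (hSC : SC = SI n N S ⊔ ⨆ i ∈ Finset.Icc 1 m,
      Submodule.map (phi n N x z (k 1 - k i) (k i - k (i + 1))) (SA i))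
    (μ : ℕ) (hμ1 : 1 ≤ μ) (hμm : μ ≤ m)
    (hnondeg : ∀ i, 1 ≤ i → i < μ → ∀ w ∈ SA i, w ≠ 0 → D i ≤ wgt w) :
    ∀ v ∈ perp (symplFB n N) SC, v ∉ SC →
      ∀ c : ℕ, (∀ i, 1 ≤ i → i < μ → c ≤ d i * D i) →
        (∀ i, μ ≤ i → i ≤ m → c ≤ d μ * D i) →
        c ≤ swtB v := by
  intro v hv hvC c hc1 hc2
  have hanti : ∀ a b, 1 ≤ a → a ≤ b → b ≤ m + 1 → k b ≤ k a := by
    intro a b ha hab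
    induction b, hab using Nat.le_induction with
    | base => exact fun _ => le_rfl
    | succ b hab ih => exact fun hb => (hk b (by omega) (by omega)).le.trans (ih (by omega))
  set w : ∀ i, Outer (k i - k (i + 1)) N :=
    fun i => outerCoord x z (k 1 - k i) (k i - k (i + 1)) v with hw
  have hvS : ∀ j, v j ∈ perp (symplF n) S := by
    intro j s hs
    have h := hv (Pi.single j s) (by
      rw [hSC]
      refine Submodule.mem_sup_left fun i _ => ?_
      by_cases hij : i = j
      · subst hij; simpa using hs
      · simp [hij])
    simp only [symplFB, sumForm, LinearMap.mk₂_apply] at h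
    rw [Finset.sum_eq_single j (fun b _ hb => by simp [hb]) (by simp)] at h
    simpa using h
  have hwperp : ∀ i, 1 ≤ i → i ≤ m → w i ∈ perp (symplFO (k i - k (i + 1)) N) (SA i) := by
    intro i h1 h2 u hu
    rw [hw, ← symplFB_phi]
    refine hv _ ?_
    rw [hSC]
    exact Submodule.mem_sup_right (Submodule.mem_iSup_of_mem i
      (Submodule.mem_iSup_of_mem (Finset.mem_Icc.2 ⟨h1, h2⟩) (Submodule.mem_map_of_mem hu)))
  obtain ⟨i, hi1, him, hi⟩ : ∃ i, 1 ≤ i ∧ i ≤ m ∧ w i ∉ SA i := by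
    by_contra! hall
    apply hvC
    rw [hSC, ← sub_add_cancel v (∑ i ∈ Finset.Icc 1 m,
      phi n N x z (k 1 - k i) (k i - k (i + 1)) (w i))]
    refine Submodule.add_mem_sup (fun j _ => ?_) (Submodule.sum_mem _ fun i hi => ?_)
    · rw [Pi.sub_apply, Finset.sum_apply, hw, sum_phi_eq_logicalPart hk
        (fun i h1 h2 => hanti 1 i le_rfl h1 (by omega)) x z v j le_rfl, hklast, Nat.sub_zero]
      exact sub_logicalPart_mem hxS hzS hxx hzz hxz (hdual ▸ hvS j)
    · have hi' := Finset.mem_Icc.1 hi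
      exact Submodule.mem_iSup_of_mem i (Submodule.mem_iSup_of_mem hi
        (Submodule.mem_map_of_mem (hall i hi'.1 hi'.2)))
  have key : ∀ p q, 1 ≤ p → p ≤ q → q ≤ m → (∀ i, 1 ≤ i → i < p → w i = 0) →
      d p * wgt (w q) ≤ swtB v := by
    intro p q hp hpq hq h0
    refine mul_wgt_le_swtB v (w q) fun j hj => ?_
    refine hd p hp (by omega) (v j) (mem_perp_Sstab (hvS j) fun t ht => ?_) fun hmem => hj ?_
    · obtain ⟨p, rfl⟩ : ∃ p', p = p' + 1 := ⟨p - 1, by omega⟩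
      exact symplF_eq_zero_of_outerCoord_eq_zero (m := m) (by omega)
        (fun i h1 h2 => h0 i h1 (by omega)) j ht
    · have hqp := hanti p q hp hpq (by omega)
      have hq1 := hanti 1 q le_rfl (by omega) (by omega)
      refine Prod.ext (funext fun ℓ => ?_) (funext fun ℓ => ?_)
      · have hℓ : k 1 - k q + ℓ < k 1 := by omega
        exact apply_eq_zero_of_mem_Sstab (hzS _ hℓ)
          (fun s hs => hzz _ hℓ s (by omega)) hmem
      · have hℓ : k 1 - k q + ℓ < k 1 := by omega
        exact apply_eq_zero_of_mem_Sstab (hxS _ hℓ)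
          (fun s hs => by rw [hxz _ hℓ s (by omega), if_neg (by omega)]) hmem
  by_cases hzero : ∀ i, 1 ≤ i → i < μ → w i = 0
  · have hμi : μ ≤ i := by
      by_contra! hlt
      exact hi (hzero i hi1 hlt ▸ Submodule.zero_mem _)
    exact (hc2 i hμi him).trans ((Nat.mul_le_mul_left _
      (hSAdist i hi1 him _ (hwperp i hi1 him) hi)).trans (key μ i hμ1 hμi him hzero))
  · push Not at hzero
    classical
    obtain ⟨hp1, hpμ, hp0⟩ := Nat.find_spec hzero
    have hmin := fun i => Nat.find_min hzero (m := i)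
    set p := Nat.find hzero
    have hDp : D p ≤ wgt (w p) := by
      by_cases hmem : w p ∈ SA p
      · exact hnondeg p hp1 hpμ _ hmem hp0
      · exact hSAdist p hp1 (by omega) _ (hwperp p hp1 (by omega)) hmem
    refine (hc1 p hp1 hpμ).trans ((Nat.mul_le_mul_left _ hDp).trans
      (key p p hp1 le_rfl (by omega) fun i h1 h2 => ?_))
    by_contra hne
    exact hmin i h2 ⟨h1, by omega, hne⟩
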